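/- In the F-setting below, for any two bounded functions η, ξ on {(t,b) : t ∈ ℝ, b ∈ U(t)} with values in C, one has ‖F(η) − F(ξ)‖_∞ ≤ Dδ((α+β)/(αβ)) ‖η − ξ‖_∞, where ‖η‖_∞ := sup_{t,b} ‖η(t,b)‖. -/

import Mathlib

open Filter MeasureTheory

/-- The operator `F` from the paper:
`F(η)(t,b) = ∫_{−∞}^{t} G_s(t,τ) g(τ, T̄(τ,t)b + η(τ,T̄(τ,t)b)) dτ
            − ∫_{t}^{+∞} G_u(t,τ) g(τ, T(τ,t)b + η(τ,T(τ,t)b)) dτ`. -/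
noncomputable def Fop {n : ℕ} {C : Type*} [NormedAddCommGroup C] [NormedSpace ℝ C]
    (Gs Gu : ℝ → ℝ → (Fin n → ℝ) →L[ℝ] C)
    (Tb T : ℝ → ℝ → C →L[ℝ] C)
    (g : ℝ → C → Fin n → ℝ)
    (η : ℝ → C → C) (t : ℝ) (b : C) : C :=
  (∫ τ in Set.Iic t, Gs t τ (g τ (Tb τ t b + η τ (Tb τ t b)))) -
  (∫ τ in Set.Ici t, Gu t τ (g τ (T τ t b + η τ (T τ t b))))

lemma aux_rpow (m τ θ γ ε : ℝ) (hm : 0 < m) (h1 : 0 ≤ τ → 1 ≤ m) (h2 : τ ≤ 0 → m ≤ 1)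
    (hθγ : θ ≤ γ) :
    m ^ (Real.sign τ * (θ + ε)) * m ^ (-(Real.sign τ) * (γ + ε) - 1) ≤ m ^ (-1 : ℝ) := by
  rw [← Real.rpow_add hm]
  rcases le_total 0 τ with h | h
  · apply Real.rpow_le_rpow_of_exponent_le (h1 h)
    have hs : 0 ≤ Real.sign τ := by
      rcases h.eq_or_lt with h | h
      · simp [← h]
      · simp [Real.sign_of_pos h]
    nlinarith
  · apply Real.rpow_le_rpow_of_exponent_ge hm (h2 h)
    have hs : Real.sign τ ≤ 0 := by
      rcases h.eq_or_lt with h | h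
      · simp [h]
      · simp [Real.sign_of_neg h]
    nlinarith

lemma aux_pw {E F : Type*} [NormedAddCommGroup E] [NormedSpace ℝ E]
    [NormedAddCommGroup F] [NormedSpace ℝ F] (G : E →L[ℝ] F) (v : E)
    (m x τ θ γ ε D δ c d q : ℝ) (hm : 0 < m) (hx : 0 < x)
    (h1 : 0 ≤ τ → 1 ≤ m) (h2 : τ ≤ 0 → m ≤ 1)
    (hθγ : θ ≤ γ) (hD : 0 < D) (hδ : 0 < δ) (hc : 0 ≤ c) (hd : 0 ≤ d)
    (hG : ‖G‖ ≤ D * (x / m) ^ q * m ^ (Real.sign τ * (θ + ε)))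
    (hv : ‖v‖ ≤ δ * c * d * m ^ (-(Real.sign τ) * (γ + ε) - 1)) :
    ‖G v‖ ≤ D * δ * c * (x ^ q * (m ^ (-q - 1) * d)) := by
  have key := aux_rpow m τ θ γ ε hm h1 h2 hθγ
  calc ‖G v‖ ≤ ‖G‖ * ‖v‖ := G.le_opNorm v
    _ ≤ (D * (x / m) ^ q * m ^ (Real.sign τ * (θ + ε))) *
        (δ * c * d * m ^ (-(Real.sign τ) * (γ + ε) - 1)) := by
        apply mul_le_mul hG hv (norm_nonneg _) (le_trans (norm_nonneg _) hG)
    _ = (D * δ * c * d * (x / m) ^ q) * (m ^ (Real.sign τ * (θ + ε)) *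
        m ^ (-(Real.sign τ) * (γ + ε) - 1)) := by ring
    _ ≤ (D * δ * c * d * (x / m) ^ q) * m ^ (-1 : ℝ) := by
        apply mul_le_mul_of_nonneg_left key
        positivity
    _ = D * δ * c * (x ^ q * (m ^ (-q - 1) * d)) := by
        rw [Real.div_rpow hx.le hm.le, sub_eq_add_neg, Real.rpow_add hm, Real.rpow_neg hm.le q]
        ring

lemma aux_hasDeriv (μ : ℝ → ℝ) (hμpos : ∀ t, 0 < μ t) (hμdiff : Differentiable ℝ μ)
    (x q : ℝ) (hq : q ≠ 0) (τ : ℝ) :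
    HasDerivAt (fun s => x ^ q * (μ s ^ (-q) / (-q))) (x ^ q * (μ τ ^ (-q - 1) * deriv μ τ)) τ := by
  have h := ((((hμdiff τ).hasDerivAt).rpow_const (p := -q) (Or.inl (hμpos τ).ne')).div_const
    (-q)).const_mul (x ^ q)
  have e : deriv μ τ * (-q) * μ τ ^ (-q - 1) / (-q) = μ τ ^ (-q - 1) * deriv μ τ := by
    rw [div_eq_iff (neg_ne_zero.2 hq)]
    ring
  rw [e] at h
  exact h

lemma aux_int_Iic (f f' : ℝ → ℝ) (a : ℝ) (hf : ∀ x, HasDerivAt f (f' x) x)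
    (hpos : ∀ x, 0 ≤ f' x) (hl : Tendsto f atBot (nhds 0)) :
    IntegrableOn f' (Set.Iic a) ∧ ∫ x in Set.Iic a, f' x = f a := by
  have h1 : IntegrableOn (fun x => f' (-x)) (Set.Ioi (-a)) := by
    apply integrableOn_Ioi_deriv_of_nonneg' (g := fun x => - f (-x)) (l := -0)
    · intro x _
      have := ((hf (-x)).comp x (hasDerivAt_neg x)).neg
      simpa [Function.comp_def] using! this
    · intro x _; exact hpos _
    · exact (hl.comp tendsto_neg_atTop_atBot).neg
  have h2 : IntegrableOn f' (Set.Iic a) := by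
    have := (integrableOn_Ici_iff_integrableOn_Ioi (μ := volume)).2 h1
    have h3 := this.comp_neg
    simpa using h3
  refine ⟨h2, ?_⟩
  rw [integral_Iic_of_hasDerivAt_of_tendsto' (fun x _ => hf x) h2 hl, sub_zero]

lemma aux_int_Ici (f f' : ℝ → ℝ) (a : ℝ) (hf : ∀ x, HasDerivAt f (f' x) x)
    (hpos : ∀ x, 0 ≤ f' x) (hl : Tendsto f atTop (nhds 0)) :
    IntegrableOn f' (Set.Ici a) ∧ ∫ x in Set.Ici a, f' x = - f a := by
  refine ⟨(integrableOn_Ici_iff_integrableOn_Ioi (μ := volume)).2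
    (integrableOn_Ioi_deriv_of_nonneg' (fun x _ => hf x) (fun x _ => hpos x) hl), ?_⟩
  rw [integral_Ici_eq_integral_Ioi,
    integral_Ioi_of_hasDerivAt_of_nonneg' (fun x _ => hf x) (fun x _ => hpos x) hl, zero_sub]

lemma aux_sub {C : Type*} [NormedAddCommGroup C] [NormedSpace ℝ C]
    (f₁ f₂ : ℝ → C) (K : ℝ → ℝ) (S : Set ℝ) (hS : MeasurableSet S) (c d : ℝ)
    (h₁ : Continuous f₁) (h₂ : Continuous f₂) (hK : IntegrableOn K S)
    (b₁ : ∀ x ∈ S, ‖f₁ x‖ ≤ c * K x) (b₂ : ∀ x ∈ S, ‖f₂ x‖ ≤ c * K x)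
    (b : ∀ x ∈ S, ‖f₁ x - f₂ x‖ ≤ d * K x) :
    ‖(∫ x in S, f₁ x) - ∫ x in S, f₂ x‖ ≤ d * ∫ x in S, K x := by
  have i₁ : IntegrableOn f₁ S := Integrable.mono' (hK.const_mul c)
    h₁.aestronglyMeasurable ((ae_restrict_iff' hS).2 (Eventually.of_forall b₁))
  have i₂ : IntegrableOn f₂ S := Integrable.mono' (hK.const_mul c)
    h₂.aestronglyMeasurable ((ae_restrict_iff' hS).2 (Eventually.of_forall b₂))
  rw [← integral_sub i₁ i₂, ← integral_const_mul]
  exact norm_integral_le_of_norm_le (hK.const_mul d)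
    ((ae_restrict_iff' hS).2 (Eventually.of_forall b))

lemma aux_cont {n : ℕ} {C : Type*} [NormedAddCommGroup C] [NormedSpace ℝ C]
    (G : ℝ → (Fin n → ℝ) →L[ℝ] C) (hG : ∀ p, Continuous fun τ => G τ p)
    (v : ℝ → Fin n → ℝ) (hv : Continuous v) : Continuous fun τ => G τ (v τ) := by
  have : (fun τ => G τ (v τ)) = fun τ => ∑ i, v τ i • G τ (Pi.single i 1) := by
    funext τ
    conv_lhs => rw [pi_eq_sum_univ' (v τ)]
    rw [map_sum]
    refine Finset.sum_congr rfl fun i _ => ?_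
    rw [map_smul]
  rw [this]
  exact continuous_finsetSum _ fun i _ =>
    ((continuous_apply i).comp hv).smul (hG _)

lemma aux_half {n : ℕ} {C : Type*} [NormedAddCommGroup C] [NormedSpace ℝ C]
    (μ : ℝ → ℝ) (hμpos : ∀ t, 0 < μ t) (hμmono : StrictMono μ) (hμ0 : μ 0 = 1)
    (D δ θ ε γ q t M : ℝ) (hD : 0 < D) (hδ : 0 < δ) (hθγ : θ ≤ γ) (hM0 : 0 ≤ M)
    (S : Set ℝ) (hS : MeasurableSet S)
    (hK : IntegrableOn (fun τ => μ t ^ q * (μ τ ^ (-q - 1) * deriv μ τ)) S)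
    (G : ℝ → (Fin n → ℝ) →L[ℝ] C) (hGc : ∀ p, Continuous fun τ => G τ p)
    (hG : ∀ τ ∈ S, ‖G τ‖ ≤ D * (μ t / μ τ) ^ q * μ τ ^ (Real.sign τ * (θ + ε)))
    (g : ℝ → C → Fin n → ℝ)
    (hgc : Continuous fun p : ℝ × C => g p.1 p.2)
    (hg0 : ∀ t, g t 0 = 0)
    (hglip : ∀ (t : ℝ) (φ ψ : C), ‖g t φ - g t ψ‖ ≤
      δ * min 1 ‖φ - ψ‖ * deriv μ t * μ t ^ (-(Real.sign t) * (γ + ε) - 1))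
    (u v : ℝ → C) (hu : Continuous u) (hv : Continuous v)
    (huv : ∀ τ ∈ S, ‖u τ - v τ‖ ≤ M) :
    ‖(∫ τ in S, G τ (g τ (u τ))) - ∫ τ in S, G τ (g τ (v τ))‖ ≤
      D * δ * M * ∫ τ in S, μ t ^ q * (μ τ ^ (-q - 1) * deriv μ τ) := by
  have hd : ∀ τ, 0 ≤ deriv μ τ := fun τ => hμmono.monotone.deriv_nonneg
  have up : ∀ τ, 0 ≤ τ → 1 ≤ μ τ := fun τ h => hμ0 ▸ hμmono.monotone h
  have dn : ∀ τ, τ ≤ 0 → μ τ ≤ 1 := fun τ h => hμ0 ▸ hμmono.monotone h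
  have gen : ∀ τ (φ ψ : C) (c : ℝ), min 1 ‖φ - ψ‖ ≤ c →
      ‖g τ φ - g τ ψ‖ ≤ δ * c * deriv μ τ * μ τ ^ (-(Real.sign τ) * (γ + ε) - 1) := by
    intro τ φ ψ c hc
    refine (hglip τ φ ψ).trans ?_
    have := hd τ
    have := Real.rpow_nonneg (hμpos τ).le (-(Real.sign τ) * (γ + ε) - 1)
    gcongr
  have one : ∀ w : ℝ → C, ∀ τ ∈ S, ‖G τ (g τ (w τ))‖ ≤
      D * δ * 1 * (μ t ^ q * (μ τ ^ (-q - 1) * deriv μ τ)) := by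
    intro w τ hτ
    have h := gen τ (w τ) 0 1 (min_le_left _ _)
    rw [hg0, sub_zero] at h
    exact aux_pw _ _ _ _ τ θ γ ε D δ 1 _ q (hμpos τ) (hμpos t) (up τ) (dn τ) hθγ hD hδ
      zero_le_one (hd τ) (hG τ hτ) h
  apply aux_sub _ _ _ S hS (D * δ * 1) (D * δ * M) _ _ hK (one u) (one v)
  · intro τ hτ
    rw [← map_sub]
    exact aux_pw _ _ _ _ τ θ γ ε D δ M _ q (hμpos τ) (hμpos t) (up τ) (dn τ) hθγ hD hδ
      hM0 (hd τ) (hG τ hτ) (gen τ _ _ M ((min_le_right _ _).trans (huv τ hτ)))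
  · exact aux_cont G hGc _ (hgc.comp (continuous_id.prodMk hu))
  · exact aux_cont G hGc _ (hgc.comp (continuous_id.prodMk hv))

/-- in the F-setting, for bounded (continuous) `η, ξ` on the bundle,
`‖F(η) − F(ξ)‖_∞ ≤ Dδ((α+β)/(αβ)) ‖η − ξ‖_∞`: whenever `M` bounds
`‖η(t,b) − ξ(t,b)‖` over the bundle, `Dδ((α+β)/(αβ)) M` bounds
`‖F(η)(t,b) − F(ξ)(t,b)‖` over the bundle. -/
theorem stmt10 {n : ℕ}
    {C : Type*} [NormedAddCommGroup C] [NormedSpace ℝ C] [CompleteSpace C]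
    (μ : ℝ → ℝ)
    (hμpos : ∀ t, 0 < μ t) (hμmono : StrictMono μ) (hμ0 : μ 0 = 1)
    (hμtop : Tendsto μ atTop atTop) (hμbot : Tendsto μ atBot (nhds 0))
    (hμdiff : Differentiable ℝ μ)
    (α β D δ θ ν ε γ : ℝ)
    (hα : 0 < α) (hβ : 0 < β) (hD : 0 < D) (hδ : 0 < δ)
    (hθ : 0 ≤ θ) (hν : 0 ≤ ν) (hε : 0 ≤ ε) (hγ : max θ ν < γ)
    (U : ℝ → Submodule ℝ C) (hUcl : ∀ t, IsClosed (U t : Set C))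
    (Tb T : ℝ → ℝ → C →L[ℝ] C)
    (hTbU : ∀ τ t : ℝ, τ ≤ t → ∀ b ∈ U t, Tb τ t b ∈ U τ)
    (hTU : ∀ τ t : ℝ, t ≤ τ → ∀ b ∈ U t, T τ t b ∈ U τ)
    (hTbc : ∀ b : C, Continuous fun p : ℝ × ℝ => Tb p.1 p.2 b)
    (hTc : ∀ b : C, Continuous fun p : ℝ × ℝ => T p.1 p.2 b)
    (Gs Gu : ℝ → ℝ → (Fin n → ℝ) →L[ℝ] C)
    (hGs : ∀ τ t : ℝ, τ ≤ t →
      ‖Gs t τ‖ ≤ D * (μ t / μ τ) ^ (-α) * μ τ ^ (Real.sign τ * (θ + ε)))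
    (hGu : ∀ τ t : ℝ, t ≤ τ →
      ‖Gu t τ‖ ≤ D * (μ t / μ τ) ^ β * μ τ ^ (Real.sign τ * (ν + ε)))
    (hGsc : ∀ p : Fin n → ℝ, Continuous fun q : ℝ × ℝ => Gs q.1 q.2 p)
    (hGuc : ∀ p : Fin n → ℝ, Continuous fun q : ℝ × ℝ => Gu q.1 q.2 p)
    (g : ℝ → C → Fin n → ℝ)
    (hgc : Continuous fun p : ℝ × C => g p.1 p.2)
    (hg0 : ∀ t, g t 0 = 0)
    (hglip : ∀ (t : ℝ) (φ ψ : C), ‖g t φ - g t ψ‖ ≤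
      δ * min 1 ‖φ - ψ‖ * deriv μ t * μ t ^ (-(Real.sign t) * (γ + ε) - 1))
    (η ξ : ℝ → C → C)
    (hηc : Continuous fun p : ℝ × C => η p.1 p.2)
    (hξc : Continuous fun p : ℝ × C => ξ p.1 p.2)
    (hηb : ∃ M : ℝ, ∀ t : ℝ, ∀ b ∈ U t, ‖η t b‖ ≤ M)
    (hξb : ∃ M : ℝ, ∀ t : ℝ, ∀ b ∈ U t, ‖ξ t b‖ ≤ M)
    (M : ℝ) (hM : ∀ t : ℝ, ∀ b ∈ U t, ‖η t b - ξ t b‖ ≤ M) :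
    ∀ t : ℝ, ∀ b ∈ U t,
      ‖Fop Gs Gu Tb T g η t b - Fop Gs Gu Tb T g ξ t b‖ ≤
        D * δ * ((α + β) / (α * β)) * M := by
  intro t b hb
  have hM0 : 0 ≤ M := (norm_nonneg _).trans (hM t b hb)
  have hd : ∀ τ, 0 ≤ deriv μ τ := fun τ => hμmono.monotone.deriv_nonneg
  have hKpos : ∀ q τ : ℝ, 0 ≤ μ t ^ q * (μ τ ^ (-q - 1) * deriv μ τ) := fun q τ =>
    mul_nonneg (Real.rpow_nonneg (hμpos t).le _)
      (mul_nonneg (Real.rpow_nonneg (hμpos τ).le _) (hd τ))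
  have hcomb : ∀ q : ℝ, μ t ^ q * μ t ^ (-q) = 1 := fun q => by
    rw [← Real.rpow_add (hμpos t), add_neg_cancel, Real.rpow_zero]
  obtain ⟨is, es⟩ := aux_int_Iic _ _ t
    (aux_hasDeriv μ hμpos hμdiff (μ t) (-α) (neg_ne_zero.2 hα.ne')) (hKpos (-α)) (by
      have h : Tendsto (fun s => μ s ^ α) atBot (nhds 0) := by
        have := hμbot.rpow_const (p := α) (Or.inr hα.le)
        rwa [Real.zero_rpow hα.ne'] at this
      simpa using (h.div_const α).const_mul (μ t ^ (-α)))
  obtain ⟨iu, eu⟩ := aux_int_Ici _ _ t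
    (aux_hasDeriv μ hμpos hμdiff (μ t) β hβ.ne') (hKpos β) (by
      have h : Tendsto (fun s => μ s ^ (-β)) atTop (nhds 0) :=
        (tendsto_rpow_neg_atTop hβ).comp hμtop
      simpa using (h.div_const (-β)).const_mul (μ t ^ β))
  have hTb1 : Continuous fun τ => Tb τ t b :=
    (hTbc b).comp (continuous_id.prodMk continuous_const)
  have hT1 : Continuous fun τ => T τ t b :=
    (hTc b).comp (continuous_id.prodMk continuous_const)
  have S := aux_half μ hμpos hμmono hμ0 D δ θ ε γ (-α) t M hD hδ
    ((le_max_left _ _).trans hγ.le) hM0 (Set.Iic t) measurableSet_Iic is (Gs t)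
    (fun p => (hGsc p).comp (continuous_const.prodMk continuous_id))
    (fun τ hτ => hGs τ t hτ) g hgc hg0 hglip
    (fun τ => Tb τ t b + η τ (Tb τ t b)) (fun τ => Tb τ t b + ξ τ (Tb τ t b))
    (hTb1.add (hηc.comp (continuous_id.prodMk hTb1)))
    (hTb1.add (hξc.comp (continuous_id.prodMk hTb1)))
    (fun τ hτ => by
      rw [add_sub_add_left_eq_sub]
      exact hM τ _ (hTbU τ t hτ b hb))
  have V := aux_half μ hμpos hμmono hμ0 D δ ν ε γ β t M hD hδ
    ((le_max_right _ _).trans hγ.le) hM0 (Set.Ici t) measurableSet_Ici iu (Gu t)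
    (fun p => (hGuc p).comp (continuous_const.prodMk continuous_id))
    (fun τ hτ => hGu τ t hτ) g hgc hg0 hglip
    (fun τ => T τ t b + η τ (T τ t b)) (fun τ => T τ t b + ξ τ (T τ t b))
    (hT1.add (hηc.comp (continuous_id.prodMk hT1)))
    (hT1.add (hξc.comp (continuous_id.prodMk hT1)))
    (fun τ hτ => by
      rw [add_sub_add_left_eq_sub]
      exact hM τ _ (hTU τ t hτ b hb))
  rw [es, ← mul_div_assoc, hcomb] at S
  rw [eu, ← mul_div_assoc, hcomb] at V
  unfold Fop
  rw [sub_sub_sub_comm]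
  refine (norm_sub_le _ _).trans ((add_le_add S V).trans (le_of_eq ?_))
  field_simp
  ring
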